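/- Let p be a polynomial with complex coefficients having at least 3 distinct roots. Assume condition (⋆): for every root ζ of p and every z ∈ B_ζ at which the derivative of N_p vanishes, the forward orbit {N_p^{∘n}(z) : n ∈ ℕ} is a finite set. Then for every root ξ of p, the fixed point ξ is the only possible critical point of N_p in the immediate basin U_ξ: if z ∈ U_ξ and the derivative of N_p at z is 0, then z = ξ. -/

import Mathlib

/-- The Newton map of a polynomial `p`: `N_p(z) = z - p(z)/p'(z)`
(with the convention that division by zero yields 0, so `N_p(z) = z` when `p'(z) = 0`). -/
noncomputable def NewtonMap (p : Polynomial ℂ) (z : ℂ) : ℂ :=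
  z - Polynomial.eval z p / Polynomial.eval z (Polynomial.derivative p)

/-- The basin of attraction of `ξ` under the Newton map of `p`:
all points whose orbit under iteration of `N_p` converges to `ξ`. -/
noncomputable def NewtonBasin (p : Polynomial ℂ) (ξ : ℂ) : Set ℂ :=
  {z : ℂ | Filter.Tendsto (fun n => (NewtonMap p)^[n] z) Filter.atTop (nhds ξ)}

/-- The immediate basin of a root `ξ`: the connected component of the basin `B_ξ`
containing `ξ`. -/
noncomputable def NewtonImmediateBasin (p : Polynomial ℂ) (ξ : ℂ) : Set ℂ :=
  connectedComponentIn (NewtonBasin p ξ) ξ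

open Set Filter Topology in
theorem aux_top {E : Type*} [TopologicalSpace E] [T2Space E] {R : ℝ}
    (F : E → Metric.ball (0 : ℂ) R) (hF : IsProperMap F)
    (hloc : IsLocalHomeomorphOn F {z | (F z : ℂ) ≠ 0})
    (hfin : {z | (F z : ℂ) = 0}.Finite)
    (K : Set E) (hK : IsPreconnected K) (w₁ w₂ : E) (h1 : w₁ ∈ K) (h2 : w₂ ∈ K)
    (hw1 : (F w₁ : ℂ) = 0) (hw2 : (F w₂ : ℂ) = 0) : w₁ = w₂ := by
  have hR : 0 < R := by
    have := (F w₁).2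
    rw [Metric.mem_ball, hw1, dist_self] at this
    exact this
  have hFc : Continuous F := hF.continuous
  let s : Set (Metric.ball (0 : ℂ) R) := {x | (x : ℂ) ≠ 0}
  have hcov0 : IsCoveringMapOn F s := by
    refine hF.isClosedMap.isCoveringMapOn_of_isLocalHomeomorphOn ?_ hloc
    intro x hx
    refine (hF.isCompact_preimage isCompact_singleton).finite ?_
    refine IsDiscrete.of_openPartialHomeomorph F subset_rfl ?_
    intro e he
    obtain ⟨φ, h, h'⟩ := hloc e (by
      have he' : F e = x := he
      have hx' : (x : ℂ) ≠ 0 := hx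
      rw [← he'] at hx'; exact hx')
    exact ⟨φ, h, h'.symm⟩
  have hcov : IsCoveringMap (s.restrictPreimage F) := hcov0.isCoveringMap_restrictPreimage
  -- separation
  obtain ⟨V₁, V₂, hV₁, hV₂, h1V, h2V, hdisj⟩ : ∃ V₁ V₂ : Set E, IsOpen V₁ ∧ IsOpen V₂ ∧
      w₁ ∈ V₁ ∧ {z | (F z : ℂ) = 0} \ {w₁} ⊆ V₂ ∧ Disjoint V₁ V₂ := by
    have hc : IsCompact ({z | (F z : ℂ) = 0} \ {w₁}) := (hfin.subset sdiff_subset).isCompact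
    obtain ⟨A, B, hA, hB, a, b, c⟩ := SeparatedNhds.of_isCompact_isCompact
      (isCompact_singleton (x := w₁)) hc (by simp)
    exact ⟨A, B, hA, hB, a rfl, b, c⟩
  obtain ⟨ε, hε, hεV⟩ : ∃ ε > 0, ∀ z, ‖(F z : ℂ)‖ < ε → z ∈ V₁ ∪ V₂ := by
    have hcl : IsClosed (F '' (V₁ ∪ V₂)ᶜ) := hF.isClosedMap _ (hV₁.union hV₂).isClosed_compl
    have h0 : (⟨0, by simpa using hR⟩ : Metric.ball (0 : ℂ) R) ∈ (F '' (V₁ ∪ V₂)ᶜ)ᶜ := by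
      rintro ⟨z, hz, hz'⟩
      apply hz
      have hz0 : (F z : ℂ) = 0 := by rw [hz']
      by_cases h : z = w₁
      · left; rw [h]; exact h1V
      · right; exact h2V ⟨hz0, h⟩
    obtain ⟨ε, hε, h⟩ := Metric.isOpen_iff.1 hcl.isOpen_compl _ h0
    refine ⟨ε, hε, fun z hz => ?_⟩
    by_contra hcon
    refine h (a := F z) ?_ ⟨z, hcon, rfl⟩
    rw [Metric.mem_ball, Subtype.dist_eq]
    simpa using hz
  obtain ⟨δ, hδ0, hδ1, hδ⟩ : ∃ δ : ℝ, 0 < δ ∧ δ ≤ 1 ∧ δ * R < ε := by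
    refine ⟨min 1 (ε / (2 * R)), by positivity, min_le_left _ _, ?_⟩
    calc min 1 (ε / (2 * R)) * R ≤ (ε / (2 * R)) * R := by gcongr; exact min_le_right _ _
      _ = ε / 2 := by field_simp
      _ < ε := by linarith
  let c : unitInterval → ℝ := fun t => 1 - t * (1 - δ)
  have hc0 : ∀ t, 0 < c t := fun t => by
    have := t.2.1; have := t.2.2; simp only [c]; nlinarith
  have hc1 : ∀ t, c t ≤ 1 := fun t => by
    have := t.2.1; have := t.2.2; simp only [c]; nlinarith
  have hcn : ∀ t (x : ℂ), ‖(c t : ℂ) * x‖ ≤ ‖x‖ := fun t x => by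
    rw [norm_mul, Complex.norm_real, Real.norm_of_nonneg (hc0 t).le]
    exact mul_le_of_le_one_left (norm_nonneg _) (hc1 t)
  let H : C(unitInterval × (F ⁻¹' s), s) :=
    { toFun := fun q => ⟨⟨(c q.1 : ℂ) * (F q.2.1 : ℂ), by
          rw [mem_ball_zero_iff]
          exact (hcn _ _).trans_lt (mem_ball_zero_iff.1 (F q.2.1).2)⟩, by
          have : (F q.2.1 : ℂ) ≠ 0 := q.2.2
          exact mul_ne_zero (by exact_mod_cast (hc0 _).ne') this⟩
      continuous_toFun := by
        refine Continuous.subtype_mk (Continuous.subtype_mk ?_ _) _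
        refine Continuous.mul ?_ ?_
        · simp only [c]; fun_prop
        · exact continuous_subtype_val.comp (hFc.comp (continuous_subtype_val.comp continuous_snd)) }
  have H0 : ∀ a, H (0, a) = s.restrictPreimage F ((ContinuousMap.id (F ⁻¹' s)) a) := by
    intro a
    apply Subtype.ext; apply Subtype.ext
    simp [H, c]
  let Φ := hcov.liftHomotopy H (ContinuousMap.id _) H0
  have hΦ0 : ∀ a, Φ (0, a) = a := fun a => hcov.liftHomotopy_zero H (ContinuousMap.id _) H0 a
  have hΦ : ∀ t a, (F (Φ (t, a)).1 : ℂ) = (c t : ℂ) * (F a.1 : ℂ) := by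
    intro t a
    have := congrFun (hcov.liftHomotopy_lifts H (ContinuousMap.id _) H0) (t, a)
    have := congrArg (fun x : s => (x.1 : ℂ)) this
    exact this
  have hΦ1 : ∀ a, (Φ (1, a)).1 ∈ V₁ ∪ V₂ := by
    intro a
    apply hεV
    rw [hΦ, norm_mul, Complex.norm_real, Real.norm_of_nonneg (hc0 _).le]
    have h : ‖(F a.1 : ℂ)‖ < R := mem_ball_zero_iff.1 (F a.1).2
    have : c 1 = δ := by simp [c]
    rw [this]
    calc δ * ‖(F a.1 : ℂ)‖ ≤ δ * R := by gcongr
      _ < ε := hδ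
  have hstay : ∀ a : F ⁻¹' s, ‖(F a.1 : ℂ)‖ < ε → (a.1 ∈ V₁ ↔ (Φ (1, a)).1 ∈ V₁) := by
    intro a ha
    let S : Set E := range fun t : unitInterval => (Φ (t, a)).1
    have hS : IsPreconnected S := isPreconnected_range (by fun_prop)
    have hSV : S ⊆ V₁ ∪ V₂ := by
      rintro _ ⟨t, rfl⟩
      apply hεV
      simp only [hΦ]
      exact (hcn _ _).trans_lt ha
    have m0 : a.1 ∈ S := ⟨0, by simp [hΦ0]⟩
    have m1 : (Φ (1, a)).1 ∈ S := ⟨1, rfl⟩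
    constructor
    · intro h
      exact hS.subset_left_of_subset_union hV₁ hV₂ hdisj hSV ⟨_, m0, h⟩ m1
    · intro h
      exact hS.subset_left_of_subset_union hV₁ hV₂ hdisj hSV ⟨_, m1, h⟩ m0
  let A : Set E := {z | z = w₁ ∨ ∃ h : z ∈ F ⁻¹' s, (Φ (1, ⟨z, h⟩)).1 ∈ V₁}
  have hsopen : IsOpen (F ⁻¹' s) := by
    refine IsOpen.preimage hFc ?_
    exact isOpen_ne.preimage continuous_subtype_val
  have hnear : ∀ z, (F z : ℂ) = 0 → ∀ᶠ y in 𝓝 z, ‖(F y : ℂ)‖ < ε := by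
    intro z hz
    have : ContinuousAt (fun y => ‖(F y : ℂ)‖) z := by fun_prop
    exact this.eventually_lt_const (by simp [hz, hε])
  have hAo : IsOpen A := by
    rw [isOpen_iff_mem_nhds]
    rintro z (rfl | ⟨hz, hzV⟩)
    · filter_upwards [hnear _ hw1, hV₁.mem_nhds h1V] with y hy hyV
      by_cases hys : y ∈ F ⁻¹' s
      · exact Or.inr ⟨hys, (hstay ⟨y, hys⟩ hy).1 hyV⟩
      · left
        by_contra hne
        have : (F y : ℂ) = 0 := by by_contra h; exact hys h
        exact hdisj.le_bot ⟨hyV, h2V ⟨this, hne⟩⟩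
    · have ho : IsOpen {a : F ⁻¹' s | (Φ (1, a)).1 ∈ V₁} := hV₁.preimage (by fun_prop)
      have ho' := hsopen.isOpenMap_subtype_val _ ho
      refine mem_of_superset (ho'.mem_nhds ⟨⟨z, hz⟩, hzV, rfl⟩) ?_
      rintro _ ⟨a, ha, rfl⟩
      exact Or.inr ⟨a.2, ha⟩
  have hAc : IsOpen Aᶜ := by
    rw [isOpen_iff_mem_nhds]
    intro z hz
    by_cases hzs : z ∈ F ⁻¹' s
    · have hzV : (Φ (1, ⟨z, hzs⟩)).1 ∈ V₂ :=
        (hΦ1 ⟨z, hzs⟩).resolve_left fun h => hz (Or.inr ⟨hzs, h⟩)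
      have ho : IsOpen {a : F ⁻¹' s | (Φ (1, a)).1 ∈ V₂} := hV₂.preimage (by fun_prop)
      have ho' := hsopen.isOpenMap_subtype_val _ ho
      refine mem_of_superset (ho'.mem_nhds ⟨⟨z, hzs⟩, hzV, rfl⟩) ?_
      rintro _ ⟨a, ha, rfl⟩
      rintro (h | ⟨h, h'⟩)
      · exact a.2 (by rw [h]; exact hw1)
      · exact hdisj.le_bot ⟨h', ha⟩
    · have hz0 : (F z : ℂ) = 0 := by by_contra h; exact hzs h
      have hzw : z ≠ w₁ := fun h => hz (Or.inl h)
      filter_upwards [hnear _ hz0, hV₂.mem_nhds (h2V ⟨hz0, hzw⟩)] with y hy hyV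
      rintro (h | ⟨h, h'⟩)
      · rw [h] at hyV; exact hdisj.le_bot ⟨h1V, hyV⟩
      · exact hdisj.le_bot ⟨(hstay ⟨y, h⟩ hy).2 h', hyV⟩
  have hA : IsClopen A := ⟨⟨hAc⟩, hAo⟩
  rcases hK.subset_isClopen hA ⟨w₁, h1, Or.inl rfl⟩ h2 with h | ⟨h, -⟩
  · exact h.symm
  · exact absurd hw2 h

open Set Filter Topology in
theorem aux_plane (f : ℂ → ℂ) (ξ : ℂ) (R : ℝ)
    (hW : IsOpen (f ⁻¹' Metric.ball ξ R))
    (hd : ∀ z ∈ f ⁻¹' Metric.ball ξ R, DifferentiableAt ℂ f z)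
    (hcrit : ∀ z ∈ f ⁻¹' Metric.ball ξ R, f z ≠ ξ → deriv f z ≠ 0)
    (hprop : ∀ K ⊆ Metric.ball ξ R, IsCompact K → IsCompact (f ⁻¹' K))
    (hfin : (f ⁻¹' {ξ}).Finite)
    (K : Set ℂ) (hK : IsPreconnected K) (hKW : K ⊆ f ⁻¹' Metric.ball ξ R)
    (w₁ w₂ : ℂ) (h1 : w₁ ∈ K) (h2 : w₂ ∈ K) (hw1 : f w₁ = ξ) (hw2 : f w₂ = ξ) : w₁ = w₂ := by
  set W := f ⁻¹' Metric.ball ξ R with hWdef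
  have hfc : ContinuousOn f W := fun z hz => (hd z hz).continuousAt.continuousWithinAt
  let F : W → Metric.ball (0 : ℂ) R := fun z => ⟨f z - ξ, by
    have : f z ∈ Metric.ball ξ R := z.2
    rw [mem_ball_zero_iff, ← dist_eq_norm]; exact this⟩
  have hFc : Continuous F :=
    Continuous.subtype_mk ((continuousOn_iff_continuous_domRestrict.1 hfc).sub continuous_const) _
  have hFp : IsProperMap F := by
    have : LocallyCompactSpace (Metric.ball (0 : ℂ) R) :=
      Metric.isOpen_ball.locallyCompactSpace
    rw [isProperMap_iff_isCompact_preimage]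
    refine ⟨hFc, fun L hL => ?_⟩
    let L' : Set ℂ := (fun x : Metric.ball (0 : ℂ) R => (x : ℂ) + ξ) '' L
    have hL' : IsCompact L' := hL.image (by fun_prop)
    have hL'b : L' ⊆ Metric.ball ξ R := by
      rintro _ ⟨x, -, rfl⟩
      have := mem_ball_zero_iff.1 x.2
      simpa [dist_eq_norm] using this
    rw [Subtype.isCompact_iff]
    convert hprop L' hL'b hL'
    ext z
    constructor
    · rintro ⟨a, ha, rfl⟩
      exact ⟨F a, ha, by simp [F]⟩
    · rintro ⟨x, hx, hxz⟩
      have hzW : z ∈ W := by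
        have : f z ∈ Metric.ball ξ R := by
          rw [← hxz]; exact hL'b ⟨x, hx, rfl⟩
        exact this
      refine ⟨⟨z, hzW⟩, ?_, rfl⟩
      have : F ⟨z, hzW⟩ = x := by
        apply Subtype.ext
        simp [F, ← hxz]
      simpa [this] using hx
  have hloc : IsLocalHomeomorphOn F {z | (F z : ℂ) ≠ 0} := by
    refine IsLocalHomeomorphOn.of_comp_left
      (g := (Subtype.val : Metric.ball (0 : ℂ) R → ℂ)) ?_ ?_ (fun x _ => hFc.continuousAt)
    · have : (Subtype.val : Metric.ball (0 : ℂ) R → ℂ) ∘ F = (fun z => f z - ξ) ∘ (Subtype.val : W → ℂ) := rfl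
      rw [this]
      refine IsLocalHomeomorphOn.comp (t := {z | z ∈ W ∧ f z ≠ ξ}) ?_
        (hW.isOpenEmbedding_subtypeVal.isLocalHomeomorph.isLocalHomeomorphOn.mono (subset_univ _)) ?_
      · rintro z ⟨hz, hz'⟩
        have han : AnalyticAt ℂ (fun z => f z - ξ) z := by
          refine DifferentiableOn.analyticAt (s := W) ?_ (hW.mem_nhds hz)
          exact fun y hy => ((hd y hy).sub_const ξ).differentiableWithinAt
        have hsd := han.hasStrictDerivAt
        have hne : deriv (fun z => f z - ξ) z ≠ 0 := by
          rw [deriv_sub_const]; exact hcrit z hz hz'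
        have hs := hsd.hasStrictFDerivAt_equiv hne
        exact ⟨hs.toOpenPartialHomeomorph _, hs.mem_toOpenPartialHomeomorph_source, rfl⟩
      · intro z hz
        exact ⟨z.2, fun h => hz (by simp [F, h])⟩
    · exact Metric.isOpen_ball.isOpenEmbedding_subtypeVal.isLocalHomeomorph.isLocalHomeomorphOn.mono
        (subset_univ _)
  have hfin' : {z | (F z : ℂ) = 0}.Finite := by
    refine Set.Finite.subset (hfin.preimage (Subtype.val_injective.injOn)) ?_
    intro z hz
    exact sub_eq_zero.1 hz
  have hK' : IsPreconnected ((Subtype.val : W → ℂ) ⁻¹' K) :=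
    hK.preimage_of_isOpenMap Subtype.val_injective hW.isOpenMap_subtype_val (by simpa using hKW)
  have := aux_top F hFp hloc hfin' _ hK' ⟨w₁, hKW h1⟩ ⟨w₂, hKW h2⟩ h1 h2 (by simp [F, hw1]) (by simp [F, hw2])
  exact congrArg Subtype.val this

open Set Filter Topology Polynomial in
theorem newton_local (p : Polynomial ℂ) (hp : p ≠ 0) (ξ : ℂ) (hroot : eval ξ p = 0) :
    ∃ c : ℂ, ‖c‖ < 1 ∧ HasDerivAt (NewtonMap p) c ξ := by
  obtain ⟨q, hq, hnd⟩ := p.exists_eq_pow_rootMultiplicity_mul_and_not_dvd hp ξ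
  have hm : 0 < p.rootMultiplicity ξ := (rootMultiplicity_pos hp).2 hroot
  obtain ⟨k, hk⟩ : ∃ k, p.rootMultiplicity ξ = k + 1 := ⟨_, (Nat.succ_pred_eq_of_pos hm).symm⟩
  rw [hk] at hq
  have hqξ : eval ξ q ≠ 0 := fun h => hnd (dvd_iff_isRoot.2 h)
  set g : ℂ → ℂ := fun z => z - (z - ξ) * (eval z q / ((k + 1) * eval z q + (z - ξ) * eval z (derivative q))) with hg
  have hpe : ∀ z, eval z p = (z - ξ) ^ (k + 1) * eval z q := fun z => by
    conv_lhs => rw [hq]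
    simp
  have hpd : ∀ z, eval z (derivative p) =
      (z - ξ) ^ k * ((k + 1) * eval z q + (z - ξ) * eval z (derivative q)) := fun z => by
    conv_lhs => rw [hq]
    simp [derivative_pow]
    ring
  have hNg : NewtonMap p = g := by
    funext z
    simp only [NewtonMap, hg, hpe, hpd]
    by_cases hz : z = ξ
    · subst hz; simp
    · have : z - ξ ≠ 0 := sub_ne_zero.2 hz
      congr 1
      rw [pow_succ, mul_assoc, mul_div_mul_left _ _ (pow_ne_zero _ this), mul_div_assoc]
  have hk1 : ((k : ℂ) + 1) ≠ 0 := by exact_mod_cast Nat.succ_ne_zero k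
  refine ⟨1 - 1 / ((k : ℂ) + 1), ?_, ?_⟩
  · have : (1 : ℂ) - 1 / ((k : ℂ) + 1) = ((k / (k + 1) : ℝ) : ℂ) := by
      push_cast; field_simp; ring
    rw [this, Complex.norm_real, Real.norm_of_nonneg (by positivity), div_lt_one (by positivity)]
    linarith
  · rw [hNg]
    have hden : ((k : ℂ) + 1) * eval ξ q + (ξ - ξ) * eval ξ (derivative q) ≠ 0 := by
      simp [hk1, hqξ]
    have hdiff : DifferentiableAt ℂ (fun z => eval z q / ((k + 1) * eval z q + (z - ξ) * eval z (derivative q))) ξ := by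
      refine DifferentiableAt.div (by fun_prop) (by fun_prop) hden
    have := (hasDerivAt_id ξ).sub (((hasDerivAt_id ξ).sub_const ξ).mul hdiff.hasDerivAt)
    refine this.congr_deriv ?_
    simp
    field_simp

open Set Filter Topology Polynomial in
theorem newton_diffAt (p : Polynomial ℂ) (z : ℂ) (hz : eval z (derivative p) ≠ 0) :
    DifferentiableAt ℂ (NewtonMap p) z := by
  unfold NewtonMap
  exact differentiableAt_id.sub (DifferentiableAt.div (by fun_prop) (by fun_prop) hz)

open Set Filter Topology Polynomial in
theorem newton_degree (p : Polynomial ℂ) (hd : 2 ≤ p.natDegree) (a : ℂ) :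
    ((X - C a) * derivative p - p).degree = (p.natDegree : WithBot ℕ) := by
  have hc : ((X - C a) * derivative p - p).coeff p.natDegree = (p.natDegree - 1) * p.leadingCoeff := by
    obtain ⟨n, hn⟩ : ∃ n, p.natDegree = n + 1 := ⟨_, (Nat.succ_pred_eq_of_pos (by omega)).symm⟩
    have h0 : p.coeff (n + 1 + 1) = 0 := coeff_eq_zero_of_natDegree_lt (by omega)
    simp only [leadingCoeff, hn, sub_mul, coeff_sub, coeff_X_mul, coeff_C_mul, coeff_derivative, h0]
    push_cast; ring
  have hp : p ≠ 0 := by rintro rfl; simp at hd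
  refine degree_eq_of_le_of_coeff_ne_zero ?_ ?_
  · refine (degree_sub_le _ _).trans (max_le ?_ degree_le_natDegree)
    refine (degree_mul_le _ _).trans ?_
    rw [degree_X_sub_C]
    have := degree_derivative_lt hp
    rw [degree_eq_natDegree hp] at this
    by_cases h : derivative p = 0
    · simp [h]
    · rw [degree_eq_natDegree h] at this ⊢
      norm_cast at this ⊢
      omega
  · rw [hc]
    refine mul_ne_zero ?_ (leadingCoeff_ne_zero.2 hp)
    rw [sub_ne_zero]
    exact_mod_cast (by omega : p.natDegree ≠ 1)

open Set Filter Topology Polynomial in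
theorem newton_fiber (p : Polynomial ℂ) (hd : 2 ≤ p.natDegree) (a : ℂ) :
    (NewtonMap p ⁻¹' {a}).Finite := by
  have hp : p ≠ 0 := by rintro rfl; simp at hd
  have h1 : (X - C a) * derivative p - p ≠ 0 := by
    intro h
    have := newton_degree p hd a
    rw [h] at this
    simp at this
  have h2 : derivative p ≠ 0 := by
    intro h
    have := derivative_eq_zero.1 h
    omega
  refine ((((X - C a) * derivative p - p).roots.toFinset ∪ (derivative p).roots.toFinset).finite_toSet).subset ?_
  intro z hz
  have hz : NewtonMap p z = a := hz
  simp only [Finset.coe_union, mem_union, Finset.mem_coe, Multiset.mem_toFinset, mem_roots h1, mem_roots h2, IsRoot]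
  by_cases h : eval z (derivative p) = 0
  · exact Or.inr h
  · left
    unfold NewtonMap at hz
    simp only [eval_sub, eval_mul, eval_X, eval_C]
    rw [← hz]
    field_simp
    ring

open Set Filter Topology Polynomial in
theorem newton_bounded (p : Polynomial ℂ) (hd : 2 ≤ p.natDegree) (M : ℝ) :
    Bornology.IsBounded {z | eval z (derivative p) ≠ 0 ∧ ‖NewtonMap p z‖ ≤ M} := by
  have hp : p ≠ 0 := by rintro rfl; simp at hd
  have hlt : (derivative p).degree < ((X - C 0) * derivative p - p).degree := by
    rw [newton_degree p hd 0, ← degree_eq_natDegree hp]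
    exact degree_derivative_lt hp
  have ho := Polynomial.isLittleO_cobounded_of_degree_lt hlt
  have hev := ho.bound (c := 1 / (2 * (|M| + 1))) (by positivity)
  rw [← Bornology.isCobounded_compl_iff, Bornology.isCobounded_def]
  filter_upwards [hev] with z hz
  rintro ⟨h1, h2⟩
  have he : eval z ((X - C 0) * derivative p - p) = NewtonMap p z * eval z (derivative p) := by
    unfold NewtonMap
    simp
    field_simp
  rw [he, norm_mul] at hz
  have hpos : 0 < ‖eval z (derivative p)‖ := norm_pos_iff.2 h1
  have h3 : ‖NewtonMap p z‖ ≤ |M| := h2.trans (le_abs_self M)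
  have h4 : 1 / (2 * (|M| + 1)) * (‖NewtonMap p z‖ * ‖eval z (derivative p)‖) ≤
      1 / (2 * (|M| + 1)) * (|M| * ‖eval z (derivative p)‖) := by gcongr
  have h5 : 1 / (2 * (|M| + 1)) * (|M| * ‖eval z (derivative p)‖) < ‖eval z (derivative p)‖ := by
    rw [one_div_mul_eq_div, div_lt_iff₀ (by positivity)]
    nlinarith [abs_nonneg M]
  linarith

open Set Filter Topology Polynomial in
theorem newton_basin_crit (p : Polynomial ℂ) (ξ z : ℂ) (hz : z ∈ NewtonBasin p ξ)
    (h : eval z (derivative p) = 0) : z = ξ := by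
  have hf : NewtonMap p z = z := by simp [NewtonMap, h]
  have : ∀ n, (NewtonMap p)^[n] z = z := fun n => Function.iterate_fixed hf n
  have hz : Tendsto (fun n => (NewtonMap p)^[n] z) atTop (𝓝 ξ) := hz
  simp only [this] at hz
  exact tendsto_nhds_unique tendsto_const_nhds hz

open Set Filter Topology Polynomial in
theorem newton_basin_diff (p : Polynomial ℂ) (hp : p ≠ 0) (ξ z : ℂ) (hroot : eval ξ p = 0)
    (hz : z ∈ NewtonBasin p ξ) : DifferentiableAt ℂ (NewtonMap p) z := by
  by_cases h : eval z (derivative p) = 0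
  · rw [newton_basin_crit p ξ z hz h]
    obtain ⟨c, -, hc⟩ := newton_local p hp ξ hroot
    exact hc.differentiableAt
  · exact newton_diffAt p z h

open Set Filter Topology Polynomial in
theorem newton_basin_iter (p : Polynomial ℂ) (ξ z : ℂ) (n : ℕ) :
    (NewtonMap p)^[n] z ∈ NewtonBasin p ξ ↔ z ∈ NewtonBasin p ξ := by
  unfold NewtonBasin
  simp only [mem_ofPred_eq, ← Function.iterate_add_apply]
  exact tendsto_add_atTop_iff_nat (f := fun m => (NewtonMap p)^[m] z) n

open Set Filter Topology Polynomial in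
theorem newton_iter_diff (p : Polynomial ℂ) (hp : p ≠ 0) (ξ z : ℂ) (hroot : eval ξ p = 0)
    (hz : z ∈ NewtonBasin p ξ) (n : ℕ) : DifferentiableAt ℂ (NewtonMap p)^[n] z := by
  induction n with
  | zero => exact differentiableAt_id
  | succ n ih =>
    rw [Function.iterate_succ']
    exact (newton_basin_diff p hp ξ _ hroot ((newton_basin_iter p ξ z n).2 hz)).comp z ih

open Set Filter Topology Polynomial in
theorem newton_iter_crit (p : Polynomial ℂ) (hp : p ≠ 0) (ξ z : ℂ) (hroot : eval ξ p = 0)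
    (hz : z ∈ NewtonBasin p ξ) (n : ℕ) (h : deriv (NewtonMap p)^[n] z = 0) :
    ∃ j, deriv (NewtonMap p) ((NewtonMap p)^[j] z) = 0 := by
  induction n with
  | zero => simp at h
  | succ n ih =>
    rw [Function.iterate_succ', deriv_comp z
      (newton_basin_diff p hp ξ _ hroot ((newton_basin_iter p ξ z n).2 hz))
      (newton_iter_diff p hp ξ z hroot hz n)] at h
    rcases mul_eq_zero.1 h with h | h
    · exact ⟨n, h⟩
    · exact ih h

open Set Filter Topology Polynomial in
theorem newton_proper (p : Polynomial ℂ) (hd : 2 ≤ p.natDegree) (ξ : ℂ) (hroot : eval ξ p = 0)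
    (K : Set ℂ) (hK : IsCompact K) (hKB : K ⊆ NewtonBasin p ξ) :
    IsCompact (NewtonMap p ⁻¹' K) := by
  have hp : p ≠ 0 := by rintro rfl; simp at hd
  obtain ⟨M, hM⟩ := hK.isBounded.exists_norm_le
  have hbas : ∀ z ∈ NewtonMap p ⁻¹' K, z ∈ NewtonBasin p ξ := fun z hz =>
    (newton_basin_iter p ξ z 1).1 (hKB hz)
  refine Metric.isCompact_of_isClosed_isBounded ?_ ?_
  · have hsub : NewtonMap p ⁻¹' K ⊆ {y | ‖eval y p‖ ≤ (‖y‖ + M) * ‖eval y (derivative p)‖} := by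
      intro y hy
      by_cases h : eval y (derivative p) = 0
      · rw [mem_ofPred_eq, newton_basin_crit p ξ y (hbas y hy) h] at *
        simp_all
      · have : eval y p = (y - NewtonMap p y) * eval y (derivative p) := by
          unfold NewtonMap; field_simp; ring
        rw [mem_ofPred_eq, this, norm_mul]
        gcongr
        exact (norm_sub_le _ _).trans (by gcongr; exact hM _ hy)
    have hcl : IsClosed {y | ‖eval y p‖ ≤ (‖y‖ + M) * ‖eval y (derivative p)‖} :=
      isClosed_le (by fun_prop) (by fun_prop)
    refine isClosed_of_closure_subset fun z hz => ?_
    have hz' := closure_minimal hsub hcl hz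
    have hcont : ContinuousAt (NewtonMap p) z := by
      by_cases h : eval z (derivative p) = 0
      · rw [mem_ofPred_eq, h] at hz'
        have h0 : eval z p = 0 := by simpa using hz'
        obtain ⟨c, -, hc⟩ := newton_local p hp z h0
        exact hc.continuousAt
      · exact (newton_diffAt p z h).continuousAt
    have := hcont.continuousWithinAt.mem_closure hz (mapsTo_preimage _ _)
    rwa [hK.isClosed.closure_eq] at this
  · refine ((newton_bounded p hd M).union (Bornology.isBounded_singleton (x := ξ))).subset ?_
    intro z hz
    by_cases h : eval z (derivative p) = 0
    · exact Or.inr (newton_basin_crit p ξ z (hbas z hz) h)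
    · exact Or.inl ⟨h, hM _ hz⟩

open Set Filter Topology Polynomial in
theorem newton_ball (p : Polynomial ℂ) (hd : 2 ≤ p.natDegree) (ξ : ℂ) (hroot : eval ξ p = 0) :
    ∃ R > 0, Metric.ball ξ R ⊆ NewtonBasin p ξ ∧
      (∀ z ∈ Metric.ball ξ R, NewtonMap p z ∈ Metric.ball ξ R) ∧
      (∀ z ∈ Metric.ball ξ R, NewtonMap p z = ξ → z = ξ) := by
  have hp : p ≠ 0 := by rintro rfl; simp at hd
  obtain ⟨c, hc1, hc⟩ := newton_local p hp ξ hroot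
  obtain ⟨r, hr, hr1⟩ := exists_between hc1
  have hr0 : 0 ≤ r := (norm_nonneg c).trans hr.le
  have hfix : NewtonMap p ξ = ξ := by simp [NewtonMap, hroot]
  have hev : ∀ᶠ z in 𝓝 ξ, ‖NewtonMap p z - ξ‖ ≤ r * ‖z - ξ‖ := by
    have ho := (hasDerivAt_iff_isLittleO.1 hc).bound (c := r - ‖c‖) (by linarith)
    filter_upwards [ho] with z hz
    rw [hfix] at hz
    have : NewtonMap p z - ξ = (NewtonMap p z - ξ - (z - ξ) • c) + (z - ξ) * c := by simp
    rw [this]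
    refine (norm_add_le _ _).trans ?_
    rw [norm_mul]
    nlinarith
  have hev2 : ∀ᶠ z in 𝓝 ξ, NewtonMap p z = ξ → z = ξ := by
    have hf : (NewtonMap p ⁻¹' {ξ} \ {ξ}).Finite := (newton_fiber p hd ξ).subset sdiff_subset
    filter_upwards [hf.isClosed.isOpen_compl.mem_nhds (x := ξ) (by simp)] with z hz h
    by_contra hne
    exact hz ⟨h, hne⟩
  obtain ⟨R, hR, hball⟩ := Metric.eventually_nhds_iff_ball.1 (hev.and hev2)
  have hinv : ∀ z ∈ Metric.ball ξ R, NewtonMap p z ∈ Metric.ball ξ R := by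
    intro z hz
    have := (hball z hz).1
    rw [mem_ball_iff_norm] at *
    nlinarith [norm_nonneg (z - ξ)]
  refine ⟨R, hR, ?_, hinv, fun z hz => (hball z hz).2⟩
  intro z hz
  have hin : ∀ n, (NewtonMap p)^[n] z ∈ Metric.ball ξ R ∧
      ‖(NewtonMap p)^[n] z - ξ‖ ≤ r ^ n * ‖z - ξ‖ := by
    intro n
    induction n with
    | zero => simpa using hz
    | succ n ih =>
      rw [Function.iterate_succ_apply']
      refine ⟨hinv _ ih.1, ((hball _ ih.1).1).trans ?_⟩
      rw [pow_succ', mul_assoc]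
      exact mul_le_mul_of_nonneg_left ih.2 hr0
  change Tendsto _ _ _
  rw [tendsto_iff_norm_sub_tendsto_zero]
  refine squeeze_zero (fun _ => norm_nonneg _) (fun n => (hin n).2) ?_
  simpa using (tendsto_pow_atTop_nhds_zero_of_lt_one hr0 hr1).mul_const ‖z - ξ‖

open Set Filter Topology Polynomial in
theorem newton_main (p : Polynomial ℂ) (hd : 2 ≤ p.natDegree)
    (ξ : ℂ) (hroot : eval ξ p = 0)
    (hstar : ∀ z ∈ NewtonBasin p ξ, deriv (NewtonMap p) z = 0 →
        Set.Finite {w : ℂ | ∃ n : ℕ, (NewtonMap p)^[n] z = w}) :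
    ∀ z ∈ NewtonImmediateBasin p ξ, deriv (NewtonMap p) z = 0 → z = ξ := by
  have hp : p ≠ 0 := by rintro rfl; simp at hd
  obtain ⟨R, hR, hRB, hinv, hpre⟩ := newton_ball p hd ξ hroot
  have hfix : NewtonMap p ξ = ξ := by simp [NewtonMap, hroot]
  have hfixn : ∀ n, (NewtonMap p)^[n] ξ = ξ := fun n => Function.iterate_fixed hfix n
  have hland : ∀ z ∈ NewtonBasin p ξ, deriv (NewtonMap p) z = 0 → ∃ m, (NewtonMap p)^[m] z = ξ := by
    intro z hz hz'
    exact (hstar z hz hz').isClosed.mem_of_tendsto hz (Eventually.of_forall fun n => ⟨n, rfl⟩)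
  have hinvn : ∀ n, ∀ z ∈ Metric.ball ξ R, (NewtonMap p)^[n] z ∈ Metric.ball ξ R := by
    intro n
    induction n with
    | zero => intro z hz; exact hz
    | succ n ih => intro z hz; rw [Function.iterate_succ_apply]; exact ih _ (hinv z hz)
  have hpren : ∀ n, ∀ z ∈ Metric.ball ξ R, (NewtonMap p)^[n] z = ξ → z = ξ := by
    intro n
    induction n with
    | zero => intro z _ h; exact h
    | succ n ih =>
      intro z hz h
      rw [Function.iterate_succ_apply] at h
      exact hpre z hz (ih _ (hinv z hz) h)
  let W : ℕ → Set ℂ := fun n => (NewtonMap p)^[n] ⁻¹' Metric.ball ξ R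
  have hWB : ∀ n, W n ⊆ NewtonBasin p ξ := fun n z hz => (newton_basin_iter p ξ z n).1 (hRB hz)
  have hWo : ∀ n, IsOpen (W n) := by
    intro n
    rw [isOpen_iff_mem_nhds]
    intro z hz
    exact (newton_iter_diff p hp ξ z hroot (hWB n hz) n).continuousAt.preimage_mem_nhds
      (Metric.isOpen_ball.mem_nhds hz)
  have hWmono : Monotone W := by
    refine monotone_nat_of_le_succ fun n z hz => ?_
    change (NewtonMap p)^[n + 1] z ∈ Metric.ball ξ R
    rw [Function.iterate_succ_apply']
    exact hinv _ hz
  have hBW : NewtonBasin p ξ ⊆ ⋃ n, W n := by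
    intro z hz
    have hz : Tendsto (fun n => (NewtonMap p)^[n] z) atTop (𝓝 ξ) := hz
    obtain ⟨n, hn⟩ := (hz.eventually (Metric.ball_mem_nhds ξ hR)).exists
    exact mem_iUnion.2 ⟨n, hn⟩
  have hBo : IsOpen (NewtonBasin p ξ) := by
    have : NewtonBasin p ξ = ⋃ n, W n := Subset.antisymm hBW (iUnion_subset hWB)
    rw [this]
    exact isOpen_iUnion hWo
  have hξB : ξ ∈ NewtonBasin p ξ := hRB (Metric.mem_ball_self hR)
  intro w hw hw'
  have hUB : NewtonImmediateBasin p ξ ⊆ NewtonBasin p ξ := connectedComponentIn_subset _ _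
  have hUo : IsOpen (NewtonImmediateBasin p ξ) := hBo.connectedComponentIn
  have hUc : IsConnected (NewtonImmediateBasin p ξ) := isConnected_connectedComponentIn_iff.2 hξB
  have hUp := hUo.isConnected_iff_isPathConnected.1 hUc
  obtain ⟨m, hm⟩ := hland w (hUB hw) hw'
  have hξU : ξ ∈ NewtonImmediateBasin p ξ := mem_connectedComponentIn hξB
  obtain ⟨γ, hγ⟩ := hUp.joinedIn w hw ξ hξU
  have hKc : IsCompact (range γ) := isCompact_range γ.continuous
  obtain ⟨n₀, hn₀⟩ := hKc.elim_directed_cover W hWo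
    ((range_subset_iff.2 hγ).trans (hUB.trans hBW)) (hWmono.directed_le)
  set n := max n₀ m with hn
  have hKn : range γ ⊆ W n := hn₀.trans (hWmono (le_max_left _ _))
  have hcomp : ∀ k, ∀ K : Set ℂ, IsCompact K → K ⊆ NewtonBasin p ξ →
      IsCompact ((NewtonMap p)^[k] ⁻¹' K) := by
    intro k
    induction k with
    | zero => intro K hK _; exact hK
    | succ k ih =>
      intro K hK hKB
      rw [Function.iterate_succ', preimage_comp]
      exact ih _ (newton_proper p hd ξ hroot K hK hKB) fun z hz =>
        (newton_basin_iter p ξ z 1).1 (hKB hz)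
  have hfinn : ∀ k, ((NewtonMap p)^[k] ⁻¹' {ξ}).Finite := by
    intro k
    induction k with
    | zero => exact finite_singleton ξ
    | succ k ih =>
      rw [Function.iterate_succ, preimage_comp]
      exact ih.preimage' fun b _ => newton_fiber p hd b
  refine aux_plane (NewtonMap p)^[n] ξ R (hWo n)
    (fun z hz => newton_iter_diff p hp ξ z hroot (hWB n hz) n) ?_
    (fun K hK hKc => hcomp n K hKc (hK.trans hRB)) (hfinn n) (range γ)
    (isPreconnected_range γ.continuous) hKn w ξ ⟨0, γ.source⟩ ⟨1, γ.target⟩ ?_ (hfixn n)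
  · intro z hz hne h0
    have hzB := hWB n hz
    obtain ⟨j, hj⟩ := newton_iter_crit p hp ξ z hroot hzB n h0
    obtain ⟨k, hk⟩ := hland _ ((newton_basin_iter p ξ z j).2 hzB) hj
    rw [← Function.iterate_add_apply] at hk
    apply hne
    refine hpren (k + j) _ hz ?_
    rw [← Function.iterate_add_apply, Nat.add_comm, Function.iterate_add_apply, hk, hfixn]
  · have : n = (n - m) + m := (Nat.sub_add_cancel (le_max_right _ _)).symm
    rw [this, Function.iterate_add_apply, hm, hfixn]

/-- Lemma 2.3 (Only Critical Point): for a Newton map of a polynomial with at least 3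
distinct roots satisfying condition (⋆), each root `ξ` is the only possible critical
point of the Newton map in its immediate basin `U_ξ`. -/
theorem newton_only_critical_point_in_immediate_basin
    (p : Polynomial ℂ) (hroots : 3 ≤ p.roots.toFinset.card)
    (hstar : ∀ ζ : ℂ, Polynomial.eval ζ p = 0 →
      ∀ z ∈ NewtonBasin p ζ, deriv (NewtonMap p) z = 0 →
        Set.Finite {w : ℂ | ∃ n : ℕ, (NewtonMap p)^[n] z = w})
    (ξ : ℂ) (hroot : Polynomial.eval ξ p = 0) :
    ∀ z ∈ NewtonImmediateBasin p ξ, deriv (NewtonMap p) z = 0 → z = ξ := by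
  have hd : 2 ≤ p.natDegree := by
    have h1 := Multiset.toFinset_card_le p.roots
    have h2 := p.card_roots'
    omega
  exact newton_main p hd ξ hroot (hstar ξ hroot)
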